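/- Let α≥0 and f∈M_σ(α,φ) (f bi-univalent with (1−α)zf'/f+α(1+zf''/f') ≺ φ for both f and its inverse, φ(z)=1+B₁z+B₂z²+⋯, B₁>0). Then |a₃| ≤ (B₁+|B₂−B₁|)/(1+α). -/

import Mathlib

open Metric Complex Filter Topology

/-- n-th Taylor coefficient of `f` at `0`. -/
noncomputable def tc (f : ℂ → ℂ) (n : ℕ) : ℂ := iteratedDeriv n f 0 / n.factorial

/-- **Schwarz–Pick** at the origin. -/
theorem norm_deriv_zero_le_one_sub_sq {h : ℂ → ℂ} (hd : DifferentiableOn ℂ h (ball 0 1))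
    (hb : ∀ z ∈ ball (0 : ℂ) 1, ‖h z‖ ≤ 1) : ‖deriv h 0‖ ≤ 1 - ‖h 0‖ ^ 2 := by
  have h0 : (0 : ℂ) ∈ ball (0 : ℂ) 1 := by simp
  have hnhds : ball (0 : ℂ) 1 ∈ 𝓝 (0 : ℂ) := isOpen_ball.mem_nhds h0
  have hdiff : DifferentiableAt ℂ h 0 := hd.differentiableAt hnhds
  rcases (hb 0 h0).eq_or_lt with heq | hlt
  · have hconst : h =ᶠ[𝓝 0] fun _ ↦ h 0 := by
      refine Complex.eventually_eq_of_isLocalMax_norm ?_ ?_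
      · filter_upwards [isOpen_ball.mem_nhds h0] with z hz
        exact hd.differentiableAt (isOpen_ball.mem_nhds hz)
      · filter_upwards [hnhds] with z hz
        simpa [heq] using hb z hz
    simp [hconst.deriv_eq, heq]
  set a : ℂ := h 0 with ha
  have hden : ∀ z ∈ ball (0 : ℂ) 1, 1 - starRingEnd ℂ a * h z ≠ 0 := by
    intro z hz hzero
    have h1 : ‖starRingEnd ℂ a * h z‖ = 1 := by rw [← sub_eq_zero.mp hzero]; simp
    rw [norm_mul, RCLike.norm_conj] at h1
    nlinarith [hb z hz, norm_nonneg a, norm_nonneg (h z)]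
  set k : ℂ → ℂ := fun z ↦ (h z - a) / (1 - starRingEnd ℂ a * h z) with hk
  have hk0 : k 0 = 0 := by simp [hk, ← ha]
  have hkd : DifferentiableOn ℂ k (ball 0 1) :=
    (hd.sub_const a).div ((hd.const_mul _).const_sub 1) hden
  have hmaps : Set.MapsTo k (ball 0 1) (closedBall (k 0) 1) := by
    intro z hz
    rw [hk0, mem_closedBall_zero_iff, norm_div, div_le_one (norm_pos_iff.mpr (hden z hz))]
    refine abs_le_of_sq_le_sq' ?_ (norm_nonneg _) |>.2
    have e : ‖1 - starRingEnd ℂ a * h z‖ ^ 2 - ‖h z - a‖ ^ 2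
        = (1 - ‖a‖ ^ 2) * (1 - ‖h z‖ ^ 2) := by
      simp only [← Complex.normSq_eq_norm_sq, Complex.normSq_apply]
      simp
      ring
    have h1 : 0 ≤ 1 - ‖a‖ ^ 2 := by nlinarith [norm_nonneg a]
    have h2 : 0 ≤ 1 - ‖h z‖ ^ 2 := by nlinarith [norm_nonneg (h z), hb z hz]
    nlinarith [mul_nonneg h1 h2]
  have hder : deriv k 0 = deriv h 0 / (1 - starRingEnd ℂ a * a) := by
    have h1 := ((hdiff.hasDerivAt.sub_const a).div
      ((hdiff.hasDerivAt.const_mul (starRingEnd ℂ a)).const_sub 1) (hden 0 h0)).deriv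
    have h2 := hden 0 h0
    rw [← ha] at h1 h2
    refine h1.trans ?_
    field_simp
    ring
  have hle := Complex.norm_deriv_le_one_of_mapsTo_ball hkd hmaps one_pos
  have hpos : 0 < 1 - ‖a‖ ^ 2 := by nlinarith [norm_nonneg a]
  have hnorm : ‖1 - starRingEnd ℂ a * a‖ = 1 - ‖a‖ ^ 2 := by
    rw [Complex.conj_mul', ← Complex.ofReal_pow, ← Complex.ofReal_one, ← Complex.ofReal_sub,
      Complex.norm_real, Real.norm_of_nonneg hpos.le]
  rwa [hder, norm_div, hnorm, div_le_one hpos] at hle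

@[simp] theorem tc_zero (f : ℂ → ℂ) : tc f 0 = f 0 := by simp [tc]

theorem tc_one (f : ℂ → ℂ) : tc f 1 = deriv f 0 := by simp [tc]

theorem tc_deriv (f : ℂ → ℂ) (n : ℕ) : tc (deriv f) n = (n + 1) * tc f (n + 1) := by
  have h1 : ((n : ℂ) + 1) ≠ 0 := by exact_mod_cast n.succ_ne_zero
  have h2 : (n.factorial : ℂ) ≠ 0 := by exact_mod_cast n.factorial_ne_zero
  rw [tc, tc, iteratedDeriv_succ', Nat.factorial_succ]
  push_cast
  field_simp

theorem tc_congr {f g : ℂ → ℂ} (h : f =ᶠ[𝓝 0] g) (n : ℕ) : tc f n = tc g n := by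
  rw [tc, tc, h.iteratedDeriv_eq]

theorem tc_add {f g : ℂ → ℂ} (hf : AnalyticAt ℂ f 0) (hg : AnalyticAt ℂ g 0) (n : ℕ) :
    tc (fun z ↦ f z + g z) n = tc f n + tc g n := by
  rw [tc, tc, tc, ← add_div]
  exact congrArg (· / _) (iteratedDeriv_add hf.contDiffAt hg.contDiffAt)

theorem tc_const_mul (c : ℂ) (f : ℂ → ℂ) (n : ℕ) :
    tc (fun z ↦ c * f z) n = c * tc f n := by
  rw [tc, tc, iteratedDeriv_const_mul_field, mul_div_assoc]

theorem tc_mul {f g : ℂ → ℂ} (hf : AnalyticAt ℂ f 0) (hg : AnalyticAt ℂ g 0) (n : ℕ) :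
    tc (fun z ↦ f z * g z) n = ∑ i ∈ Finset.range (n + 1), tc f i * tc g (n - i) := by
  rw [tc, iteratedDeriv_fun_mul hf.contDiffAt hg.contDiffAt, Finset.sum_div]
  refine Finset.sum_congr rfl fun i hi ↦ ?_
  have hin : i ≤ n := Nat.lt_succ_iff.mp (Finset.mem_range.mp hi)
  have h1 : (i.factorial : ℂ) ≠ 0 := by exact_mod_cast i.factorial_ne_zero
  have h2 : ((n - i).factorial : ℂ) ≠ 0 := by exact_mod_cast (n - i).factorial_ne_zero
  rw [tc, tc, Nat.cast_choose ℂ hin]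
  have h3 : (n.factorial : ℂ) ≠ 0 := by exact_mod_cast n.factorial_ne_zero
  field_simp

theorem tc_id_mul_succ {f : ℂ → ℂ} (hf : AnalyticAt ℂ f 0) (n : ℕ) :
    tc (fun z ↦ z * f z) (n + 1) = tc f n := by
  have h1 : ∀ k, tc (fun z : ℂ ↦ z) k = if k = 1 then 1 else 0 := by
    intro k
    rcases k with _ | _ | k
    · simp
    · simp [tc_one]
    · simp [tc, iteratedDeriv_succ', iteratedDeriv_const]
  rw [tc_mul (f := fun z ↦ z) analyticAt_id hf, Finset.sum_eq_single 1]
  · simp [h1]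
  · intro i _ hi
    simp [h1, hi]
  · simp

theorem tc_comp_one {f g : ℂ → ℂ} (hf : AnalyticAt ℂ f 0) (hg : AnalyticAt ℂ g 0)
    (hf0 : f 0 = 0) : tc (fun z ↦ g (f z)) 1 = tc g 1 * tc f 1 := by
  simp only [tc_one]
  rw [← hf0] at hg
  have := deriv_comp 0 hg.differentiableAt hf.differentiableAt
  rwa [hf0] at this

theorem tc_comp_two {f g : ℂ → ℂ} (hf : AnalyticAt ℂ f 0) (hg : AnalyticAt ℂ g 0)
    (hf0 : f 0 = 0) : tc (fun z ↦ g (f z)) 2 = tc g 2 * tc f 1 ^ 2 + tc g 1 * tc f 2 := by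
  rw [← hf0] at hg
  have := iteratedDeriv_comp_two (hg.contDiffAt (n := 2)) hf.contDiffAt
  rw [hf0] at this
  simp only [tc_one]
  rw [tc, tc, tc, show (fun z ↦ g (f z)) = g ∘ f from rfl, this]
  ring

theorem tc_comp_three {f g : ℂ → ℂ} (hf : AnalyticAt ℂ f 0) (hg : AnalyticAt ℂ g 0)
    (hf0 : f 0 = 0) : tc (fun z ↦ g (f z)) 3 =
      tc g 3 * tc f 1 ^ 3 + 2 * tc g 2 * tc f 2 * tc f 1 + tc g 1 * tc f 3 := by
  rw [← hf0] at hg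
  have := iteratedDeriv_comp_three (hg.contDiffAt (n := 3)) hf.contDiffAt
  rw [hf0] at this
  simp only [tc_one]
  rw [tc, tc, tc, tc, tc, show (fun z ↦ g (f z)) = g ∘ f from rfl, this]
  simp [Nat.factorial]
  ring

/-- The second coefficient of a self-map of the unit disc fixing the origin. -/
theorem norm_tc_two_le {u : ℂ → ℂ} (hu : AnalyticOn ℂ u (ball 0 1))
    (humap : ∀ z ∈ ball (0 : ℂ) 1, u z ∈ ball (0 : ℂ) 1) (hu0 : u 0 = 0) :
    ‖tc u 2‖ ≤ 1 - ‖tc u 1‖ ^ 2 := by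
  have hnhds : ball (0 : ℂ) 1 ∈ 𝓝 (0 : ℂ) := ball_mem_nhds _ one_pos
  have hd : DifferentiableOn ℂ (dslope u 0) (ball 0 1) :=
    (Complex.differentiableOn_dslope hnhds).mpr hu.differentiableOn
  have hmaps : Set.MapsTo u (ball 0 1) (closedBall (u 0) 1) := fun z hz ↦ by
    rw [hu0]; exact ball_subset_closedBall (humap z hz)
  have hb : ∀ z ∈ ball (0 : ℂ) 1, ‖dslope u 0 z‖ ≤ 1 := fun z hz ↦ by
    simpa using Complex.norm_dslope_le_div_of_mapsTo_ball hu.differentiableOn hmaps hz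
  have heq : u = fun z ↦ z * dslope u 0 z := by
    funext z
    simpa [hu0] using (sub_smul_dslope u 0 z).symm
  have h2 : tc u 2 = deriv (dslope u 0) 0 := by
    rw [← tc_one, ← tc_id_mul_succ (hd.analyticAt hnhds) 1, ← heq]
  have h1 : tc u 1 = dslope u 0 0 := by simp [tc_one]
  rw [h1, h2]
  exact norm_deriv_zero_le_one_sub_sq hd hb

/-- Comparison of the first two coefficients in the defining equation of the class. -/
theorem coeff_relations {f u φ : ℂ → ℂ} {α : ℂ}
    (hf : AnalyticOn ℂ f (ball (0 : ℂ) 1)) (hfinj : Set.InjOn f (ball (0 : ℂ) 1))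
    (hf0 : f 0 = 0) (hf1 : deriv f 0 = 1)
    (hu : AnalyticOn ℂ u (ball (0 : ℂ) 1)) (hu0 : u 0 = 0)
    (hφ : AnalyticOn ℂ φ (ball (0 : ℂ) 1)) (hφ0 : φ 0 = 1)
    (hfu : ∀ z ∈ ball (0 : ℂ) 1, z ≠ 0 →
      (1 - α) * (z * deriv f z / f z)
        + α * (1 + z * iteratedDeriv 2 f z / deriv f z) = φ (u z)) :
    (1 + α) * tc f 2 = tc φ 1 * tc u 1 ∧
    2 * (1 + 2 * α) * tc f 3 - (1 + 3 * α) * tc f 2 ^ 2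
      = tc φ 1 * tc u 2 + tc φ 2 * tc u 1 ^ 2 := by
  have h0 : (0 : ℂ) ∈ ball (0 : ℂ) 1 := by simp
  have hnhds : ball (0 : ℂ) 1 ∈ 𝓝 (0 : ℂ) := isOpen_ball.mem_nhds h0
  have hfa : AnalyticAt ℂ f 0 := hf.differentiableOn.analyticAt hnhds
  have hua : AnalyticAt ℂ u 0 := hu.differentiableOn.analyticAt hnhds
  have hφa : AnalyticAt ℂ φ 0 := hφ.differentiableOn.analyticAt hnhds
  have hf'a : AnalyticAt ℂ (deriv f) 0 := hfa.deriv
  have hf''a : AnalyticAt ℂ (deriv (deriv f)) 0 := hf'a.deriv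
  have hca : AnalyticAt ℂ (fun z ↦ φ (u z)) 0 := AnalyticAt.fun_comp (by rwa [hu0]) hua
  have hf'ne : ∀ᶠ z in 𝓝 (0 : ℂ), deriv f z ≠ 0 :=
    hf'a.continuousAt.eventually_ne (by simp [hf1])
  have hpa : AnalyticAt ℂ (fun z ↦ deriv f z * φ (u z)) 0 := hf'a.fun_mul hca
  have key : (fun z ↦ (1 - α) * (z * (deriv f z * deriv f z))
        + α * (f z * (deriv f z + z * deriv (deriv f) z)))
      =ᶠ[𝓝 0] fun z ↦ f z * (deriv f z * φ (u z)) := by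
    filter_upwards [hnhds, hf'ne] with z hz hz'
    rcases eq_or_ne z 0 with rfl | hne
    · simp [hf0]
    have hfz : f z ≠ 0 := fun h ↦ hne (hfinj hz h0 (h.trans hf0.symm))
    rw [← hfu z hz hne, iteratedDeriv_succ, iteratedDeriv_one]
    field_simp
  have expand : ∀ n, (1 - α) * tc (fun z ↦ deriv f z * deriv f z) n
      + α * tc (fun z ↦ f z * (deriv f z + z * deriv (deriv f) z)) (n + 1)
      = tc (fun z ↦ f z * (deriv f z * φ (u z))) (n + 1) := by
    intro n
    rw [← tc_congr key, tc_add (by fun_prop) (by fun_prop), tc_const_mul, tc_const_mul,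
      tc_id_mul_succ (by fun_prop)]
  have tc1 : tc f 1 = 1 := by rw [tc_one, hf1]
  have hsum : ∀ n, tc (fun z ↦ deriv f z + z * deriv (deriv f) z) (n + 1)
      = (n + 2) * tc f (n + 2) + (n + 2) * (n + 1) * tc f (n + 2) := by
    intro n
    rw [tc_add (by fun_prop) (by fun_prop), tc_id_mul_succ hf''a, tc_deriv, tc_deriv, tc_deriv]
    push_cast
    ring
  have e1 := expand 1
  have e2 := expand 2
  rw [tc_mul hf'a hf'a, tc_mul hfa (by fun_prop), tc_mul hfa hpa] at e1 e2
  simp only [Finset.sum_range_succ, Finset.sum_range_zero, Nat.reduceAdd, Nat.reduceSub,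
    tc_mul hf'a hca, tc_deriv, hsum 0, hsum 1, tc_comp_one hua hφa hu0,
    tc_comp_two hua hφa hu0, tc_zero, tc1, hf0, hf1, hu0, hφ0] at e1 e2
  norm_num at e1 e2
  have r1 : (1 + α) * tc f 2 = tc φ 1 * tc u 1 := by linear_combination e1
  refine ⟨r1, ?_⟩
  linear_combination e2 - 3 * tc f 2 * r1

/-- The first coefficients of the local inverse of a normalized function. -/
theorem coeff_inverse {f g : ℂ → ℂ} (hf : AnalyticAt ℂ f 0) (hg : AnalyticAt ℂ g 0)
    (hf0 : f 0 = 0) (hf1 : deriv f 0 = 1) (hinv : ∀ᶠ z in 𝓝 (0 : ℂ), g (f z) = z) :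
    g 0 = 0 ∧ deriv g 0 = 1 ∧ tc g 2 = -tc f 2 ∧ tc g 3 = 2 * tc f 2 ^ 2 - tc f 3 := by
  have hid : (fun z ↦ g (f z)) =ᶠ[𝓝 0] fun z ↦ z * 1 := by
    simpa [EventuallyEq] using hinv
  have e0 := hinv.self_of_nhds
  have e1 := tc_congr hid 1
  have e2 := tc_congr hid 2
  have e3 := tc_congr hid 3
  rw [tc_id_mul_succ analyticAt_const] at e1 e2 e3
  rw [tc_comp_one hf hg hf0] at e1
  rw [tc_comp_two hf hg hf0] at e2
  rw [tc_comp_three hf hg hf0] at e3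
  simp only [tc_one, hf1, tc_zero, deriv_const, mul_one, one_pow] at e1 e2 e3
  have hc : tc (fun _ : ℂ ↦ (1 : ℂ)) 2 = 0 := by simp [tc, iteratedDeriv_const]
  rw [e1] at e2 e3
  rw [hc] at e3
  rw [hf0] at e0
  have hg2 : tc g 2 = -tc f 2 := by linear_combination e2
  refine ⟨e0, e1, hg2, ?_⟩
  rw [hg2] at e3
  linear_combination e3

theorem stmt15 (f g u v φ : ℂ → ℂ) (α B₁ B₂ : ℝ) (hα : 0 ≤ α)
    (hf : AnalyticOn ℂ f (ball (0:ℂ) 1)) (hfinj : Set.InjOn f (ball (0:ℂ) 1))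
    (hf0 : f 0 = 0) (hf1 : deriv f 0 = 1)
    (hg : AnalyticOn ℂ g (ball (0:ℂ) 1)) (hginj : Set.InjOn g (ball (0:ℂ) 1))
    (hinv : ∀ᶠ z in 𝓝 (0:ℂ), g (f z) = z)
    (hu : AnalyticOn ℂ u (ball (0:ℂ) 1)) (humap : ∀ z ∈ ball (0:ℂ) 1, u z ∈ ball (0:ℂ) 1) (hu0 : u 0 = 0)
    (hv : AnalyticOn ℂ v (ball (0:ℂ) 1)) (hvmap : ∀ w ∈ ball (0:ℂ) 1, v w ∈ ball (0:ℂ) 1) (hv0 : v 0 = 0)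
    (hφ : AnalyticOn ℂ φ (ball (0:ℂ) 1)) (hφ0 : φ 0 = 1)
    (hB₁ : tc φ 1 = (B₁ : ℂ)) (hB₂ : tc φ 2 = (B₂ : ℂ)) (hB₁pos : 0 < B₁)
    (hfu : ∀ z ∈ ball (0:ℂ) 1, z ≠ 0 →
      (1 - (α : ℂ)) * (z * deriv f z / f z)
        + (α : ℂ) * (1 + z * iteratedDeriv 2 f z / deriv f z) = φ (u z))
    (hgv : ∀ w ∈ ball (0:ℂ) 1, w ≠ 0 →
      (1 - (α : ℂ)) * (w * deriv g w / g w)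
        + (α : ℂ) * (1 + w * iteratedDeriv 2 g w / deriv g w) = φ (v w)) :
    ‖tc f 3‖ ≤ (B₁ + |B₂ - B₁|) / (1 + α) := by
  have hnhds : ball (0 : ℂ) 1 ∈ 𝓝 (0 : ℂ) := ball_mem_nhds _ one_pos
  obtain ⟨hg0, hg1, hg2, hg3⟩ := coeff_inverse (hf.differentiableOn.analyticAt hnhds)
    (hg.differentiableOn.analyticAt hnhds) hf0 hf1 hinv
  obtain ⟨f1, f2⟩ := coeff_relations hf hfinj hf0 hf1 hu hu0 hφ hφ0 hfu
  obtain ⟨g1, g2⟩ := coeff_relations hg hginj hg0 hg1 hv hv0 hφ hφ0 hgv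
  rw [hB₁] at f1 f2 g1 g2
  rw [hB₂] at f2 g2
  rw [hg2] at g1 g2
  rw [hg3] at g2
  have hB : (B₁ : ℂ) ≠ 0 := by exact_mod_cast hB₁pos.ne'
  have huv : tc v 1 = -tc u 1 := mul_left_cancel₀ hB (by linear_combination -f1 - g1)
  have hu2 := norm_tc_two_le hu humap hu0
  have hv2 := norm_tc_two_le hv hvmap hv0
  rw [huv] at hv2 g2
  rw [norm_neg] at hv2
  have main : ((4 * (1 + α) * (1 + 2 * α) : ℝ) : ℂ) * tc f 3 =
      ((B₁ * (3 + 5 * α) : ℝ) : ℂ) * tc u 2 + ((B₁ * (1 + 3 * α) : ℝ) : ℂ) * tc v 2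
        + ((4 * (1 + 2 * α) * B₂ : ℝ) : ℂ) * tc u 1 ^ 2 := by
    push_cast
    linear_combination (3 + 5 * (α : ℂ)) * f2 + (1 + 3 * (α : ℂ)) * g2
  have hnorm := congrArg norm main
  rw [norm_mul, Complex.norm_real, Real.norm_of_nonneg (by positivity)] at hnorm
  have htri := norm_add₃_le (a := ((B₁ * (3 + 5 * α) : ℝ) : ℂ) * tc u 2)
    (b := ((B₁ * (1 + 3 * α) : ℝ) : ℂ) * tc v 2)
    (c := ((4 * (1 + 2 * α) * B₂ : ℝ) : ℂ) * tc u 1 ^ 2)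
  rw [← hnorm] at htri
  simp only [norm_mul, norm_pow, Complex.norm_real] at htri
  rw [Real.norm_of_nonneg (by positivity : 0 ≤ B₁),
    Real.norm_of_nonneg (by positivity : 0 ≤ 3 + 5 * α),
    Real.norm_of_nonneg (by positivity : 0 ≤ 1 + 3 * α),
    Real.norm_of_nonneg (by norm_num : (0 : ℝ) ≤ 4),
    Real.norm_of_nonneg (by positivity : 0 ≤ 1 + 2 * α), Real.norm_eq_abs] at htri
  set t := ‖tc u 1‖ ^ 2 with ht
  have ht0 : 0 ≤ t := by positivity
  have ht1 : t ≤ 1 := by linarith [norm_nonneg (tc u 2)]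
  have hB2 : |B₂| ≤ B₁ + |B₂ - B₁| := by
    have := abs_add_le B₁ (B₂ - B₁)
    rwa [add_sub_cancel, abs_of_pos hB₁pos] at this
  have b1 := mul_le_mul_of_nonneg_left hu2 (by positivity : 0 ≤ B₁ * (3 + 5 * α))
  have b2 := mul_le_mul_of_nonneg_left hv2 (by positivity : 0 ≤ B₁ * (1 + 3 * α))
  have b3 : B₁ * (1 - t) + |B₂| * t ≤ B₁ + |B₂ - B₁| := by
    nlinarith [mul_nonneg (abs_nonneg (B₂ - B₁)) (sub_nonneg.mpr ht1),
      mul_le_mul_of_nonneg_right hB2 ht0]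
  have b4 := mul_le_mul_of_nonneg_left b3 (by positivity : 0 ≤ 4 * (1 + 2 * α))
  rw [le_div_iff₀ (by positivity)]
  refine le_of_mul_le_mul_left ?_ (by positivity : 0 < 4 * (1 + 2 * α))
  linarith
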